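/- Sharp positivity criterion: let π : [0,1] → ℝ be continuously differentiable on [0,1] and set v_i = Kπ. Then π(s) > 0 for all s ∈ (0,1] if and only if (1/s) ∫₀ˢ v_i(σ) dσ > v_i(s) for all s ∈ (0,1], i.e. the price is everywhere positive exactly when the expected incentive at each saturation is strictly smaller than the average expected incentive before it. -/

import Mathlib

open MeasureTheory Set

lemma intervalIntegrable_div_of_continuous {p : ℝ → ℝ} (hp : Continuous p) {a b : ℝ}
    (ha : 0 < a) (hb : 0 < b) : IntervalIntegrable (fun t => p t / t) volume a b := by
  refine ContinuousOn.intervalIntegrable (hp.continuousOn.div continuousOn_id fun t ht => ?_)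
  exact ((lt_min ha hb).trans_le ht.1).ne'

lemma hasDerivAt_integral_div {p : ℝ → ℝ} (hp : Continuous p) {x b : ℝ}
    (hx : 0 < x) (hb : 0 < b) :
    HasDerivAt (fun σ => ∫ t in σ..b, p t / t) (-(p x / x)) x := by
  have hc : ContinuousOn (fun t => p t / t) (Ioi 0) :=
    hp.continuousOn.div continuousOn_id fun t ht => (ne_of_gt ht : t ≠ 0)
  exact intervalIntegral.integral_hasDerivAt_left
    (intervalIntegrable_div_of_continuous hp hx hb)
    (hc.stronglyMeasurableAtFilter isOpen_Ioi x hx)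
    (hc.continuousAt (Ioi_mem_nhds hx))

lemma abs_integral_div_le {p : ℝ → ℝ} {C : ℝ}
    (hC : ∀ t, |p t| ≤ C) {x : ℝ} (hx : x ∈ Ioc (0 : ℝ) 1) :
    |∫ t in x..(1 : ℝ), p t / t| ≤ C * -Real.log x := by
  have h := intervalIntegral.norm_integral_le_of_norm_le (μ := volume) (f := fun t => p t / t)
    (g := fun t => C / t) hx.2 (Filter.Eventually.of_forall fun t ht => ?_)
    (intervalIntegrable_div_of_continuous continuous_const hx.1 one_pos)
  · simpa [div_eq_mul_inv, integral_inv_of_pos hx.1 one_pos] using h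
  · have ht0 : 0 < t := hx.1.trans ht.1
    rw [Real.norm_eq_abs, abs_div, abs_of_pos ht0]
    gcongr
    exact hC t

/-- The running integral of the incentive `σ ↦ ∫_σ¹ p(t)/t dt − p(σ)` has the closed form
`s ∫_s¹ p(t)/t dt`. -/
lemma integral_incentive {p : ℝ → ℝ} (hp : Continuous p) {C : ℝ} (hC : ∀ t, |p t| ≤ C)
    {s : ℝ} (hs : s ∈ Ioc (0 : ℝ) 1) :
    ∫ σ in (0 : ℝ)..s, ((∫ t in σ..(1 : ℝ), p t / t) - p σ)
      = s * ∫ t in s..(1 : ℝ), p t / t := by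
  set F : ℝ → ℝ := fun σ => ∫ t in σ..(1 : ℝ), p t / t
  have hFd : ∀ x, 0 < x → HasDerivAt F (-(p x / x)) x := fun x hx =>
    hasDerivAt_integral_div hp hx one_pos
  have hFc : ContinuousOn F (Ioi 0) := fun x hx => (hFd x hx).continuousAt.continuousWithinAt
  have hFi : IntervalIntegrable F volume 0 s := by
    have hlog : IntervalIntegrable (fun x => C * -Real.log x) volume 0 s :=
      intervalIntegral.intervalIntegrable_log'.neg.const_mul C
    refine hlog.mono_fun ?_ ?_
    · rw [uIoc_of_le hs.1.le]
      exact (hFc.mono Ioc_subset_Ioi_self).aestronglyMeasurable measurableSet_Ioc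
    · rw [uIoc_of_le hs.1.le]
      refine (ae_restrict_iff' measurableSet_Ioc).2 (Filter.Eventually.of_forall fun x hx => ?_)
      exact (abs_integral_div_le hC ⟨hx.1, hx.2.trans hs.2⟩).trans (le_abs_self _)
  have hcont : ContinuousOn (fun σ => σ * F σ) (Icc 0 s) := by
    intro x hx
    rcases hx.1.eq_or_lt with rfl | hx0
    · have hlim : Filter.Tendsto (fun x : ℝ => C * |x * Real.log x|)
          (nhdsWithin 0 (Icc 0 s)) (nhds 0) := by
        have h : Continuous fun x : ℝ => C * |x * Real.log x| :=
          continuous_const.mul Real.continuous_mul_log.abs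
        simpa using (h.tendsto 0).mono_left nhdsWithin_le_nhds
      rw [ContinuousWithinAt, zero_mul]
      refine squeeze_zero_norm' (eventually_nhdsWithin_of_forall fun x hx => ?_) hlim
      rcases hx.1.eq_or_lt with rfl | hx0
      · simp
      · have hx1 : x ≤ 1 := hx.2.trans hs.2
        have h := mul_le_mul_of_nonneg_left (abs_integral_div_le hC ⟨hx0, hx1⟩) hx0.le
        rw [Real.norm_eq_abs, abs_mul, abs_mul, abs_of_pos hx0,
          abs_of_nonpos (Real.log_nonpos hx0.le hx1)]
        linarith
    · exact (continuousAt_id.mul (hFd x hx0).continuousAt).continuousWithinAt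
  have hderiv : ∀ x ∈ Ioo 0 s, HasDerivAt (fun σ => σ * F σ) (F x - p x) x := by
    intro x hx
    refine ((hasDerivAt_id x).mul (hFd x hx.1)).congr_deriv ?_
    have := hx.1.ne'
    simp only [id]
    field_simp
    ring
  have h := intervalIntegral.integral_eq_sub_of_hasDerivAt_of_le hs.1.le hcont hderiv
    (hFi.sub (hp.intervalIntegrable 0 s))
  simpa using h

/-- **Sharp positivity criterion.** Let `π` be continuously differentiable on `[0,1]`
and `v_i = Kπ`, `v_i(σ) = ∫_σ¹ π(t)/t dt − π(σ)`. Then `π > 0` on `(0,1]` if and only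
if `(1/s) ∫₀ˢ v_i(σ) dσ > v_i(s)` for all `s ∈ (0,1]`. -/
theorem sharp_positivity (π π' : ℝ → ℝ)
    (hderiv : ∀ s ∈ Set.Icc (0 : ℝ) 1, HasDerivWithinAt π (π' s) (Set.Icc (0 : ℝ) 1) s)
    (hcont : ContinuousOn π' (Set.Icc (0 : ℝ) 1)) :
    (∀ s ∈ Set.Ioc (0 : ℝ) 1, 0 < π s) ↔
    (∀ s ∈ Set.Ioc (0 : ℝ) 1,
      (1 / s) * (∫ σ in (0:ℝ)..s, ((∫ t in σ..(1:ℝ), π t / t) - π σ))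
        > (∫ t in s..(1:ℝ), π t / t) - π s) := by
  have hπ : ContinuousOn π (Icc 0 1) := fun s hs => (hderiv s hs).continuousWithinAt
  set p : ℝ → ℝ := IccExtend zero_le_one ((Icc (0 : ℝ) 1).domRestrict π)
  have hp : Continuous p := (continuousOn_iff_continuous_domRestrict.1 hπ).Icc_extend'
  have hpπ : ∀ t ∈ Icc (0 : ℝ) 1, p t = π t := fun t ht => IccExtend_of_mem _ _ ht
  obtain ⟨C, hC⟩ := isCompact_Icc.exists_bound_of_continuousOn hπ
  have hpC : ∀ t, |p t| ≤ C := fun t => hC _ (projIcc (0 : ℝ) 1 zero_le_one t).2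
  have hF : ∀ σ ∈ Icc (0 : ℝ) 1, ∫ t in σ..(1 : ℝ), π t / t = ∫ t in σ..(1 : ℝ), p t / t := by
    intro σ hσ
    refine intervalIntegral.integral_congr fun t ht => ?_
    rw [uIcc_of_le hσ.2] at ht
    simp only [hpπ t ⟨hσ.1.trans ht.1, ht.2⟩]
  refine forall₂_congr fun s hs => ?_
  have hv : ∫ σ in (0 : ℝ)..s, ((∫ t in σ..(1 : ℝ), π t / t) - π σ)
      = s * ∫ t in s..(1 : ℝ), π t / t := by
    rw [hF s ⟨hs.1.le, hs.2⟩, ← integral_incentive hp hpC hs]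
    refine intervalIntegral.integral_congr fun σ hσ => ?_
    rw [uIcc_of_le hs.1.le] at hσ
    have hσ' : σ ∈ Icc (0 : ℝ) 1 := ⟨hσ.1, hσ.2.trans hs.2⟩
    simp only [hF σ hσ', hpπ σ hσ']
  rw [hv, ← mul_assoc, one_div_mul_cancel hs.1.ne', one_mul, gt_iff_lt, sub_lt_self_iff]
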